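/- arXiv:2510.04685 — 2 statements merged into one kernel-verified Lean document; each statement's English description precedes it below -/
import Mathlib

section
/- Let A be a d×d real symmetric positive definite matrix, X ⊆ ℝ^d a convex set, and m, ∇, x' ∈ ℝ^d. Suppose x* minimizes x ↦ ⟨x, m⟩ + ½‖x − x'‖²_A over X and y* minimizes x ↦ ⟨x, ∇⟩ + ½‖x − x'‖²_A over X. Then 0 ≤ ⟨x* − y*, ∇ − m⟩ ≤ 2 (∇ − m)ᵀ A⁻¹ (∇ − m). -/
open Finset Matrix
open scoped RealInnerProductSpace

/-- Young's inequality `uᵀ g ≤ ¼ uᵀ A u + gᵀ A⁻¹ g` for a positive definite matrix `A`. -/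
theorem Matrix.PosDef.dotProduct_le_quarter_add_inv {n : Type*} [Fintype n] [DecidableEq n]
    {A : Matrix n n ℝ} (hA : A.PosDef) (u g : n → ℝ) :
    u ⬝ᵥ g ≤ (1 / 4) * (u ⬝ᵥ A *ᵥ u) + g ⬝ᵥ A⁻¹ *ᵥ g := by
  have hdet : IsUnit A.det := (Matrix.isUnit_iff_isUnit_det A).mp hA.isUnit
  have hsymm : Aᵀ = A := by simpa [Matrix.conjTranspose_eq_transpose_of_trivial] using hA.1.eq
  obtain ⟨w, rfl⟩ : ∃ w, g = A *ᵥ w :=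
    ⟨A⁻¹ *ᵥ g, by rw [mulVec_mulVec, mul_nonsing_inv A hdet, one_mulVec]⟩
  have hcomm : w ⬝ᵥ A *ᵥ u = u ⬝ᵥ A *ᵥ w := by
    rw [dotProduct_mulVec, ← mulVec_transpose, hsymm, dotProduct_comm]
  have hinv : A *ᵥ w ⬝ᵥ A⁻¹ *ᵥ A *ᵥ w = w ⬝ᵥ A *ᵥ w := by
    rw [mulVec_mulVec, nonsing_inv_mul A hdet, one_mulVec, dotProduct_comm]
  have hnonneg := hA.posSemidef.dotProduct_mulVec_nonneg ((1 / 2 : ℝ) • u - w)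
  simp only [star_trivial, mulVec_sub, mulVec_smul, dotProduct_sub, sub_dotProduct,
    smul_dotProduct, dotProduct_smul, smul_eq_mul, hcomm] at hnonneg
  rw [hinv]
  linarith

/-- The parallelogram identity for the quadratic form of a matrix, written at the midpoint. -/
theorem Matrix.dotProduct_mulVec_midpoint {n : Type*} [Fintype n]
    (A : Matrix n n ℝ) (p q : n → ℝ) :
    ((1 / 2 : ℝ) • p + (1 / 2 : ℝ) • q) ⬝ᵥ A *ᵥ ((1 / 2 : ℝ) • p + (1 / 2 : ℝ) • q)
      = (1 / 2) * (p ⬝ᵥ A *ᵥ p) + (1 / 2) * (q ⬝ᵥ A *ᵥ q)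
        - (1 / 4) * ((p - q) ⬝ᵥ A *ᵥ (p - q)) := by
  simp only [mulVec_sub, mulVec_add, mulVec_smul, dotProduct_sub, sub_dotProduct,
    dotProduct_add, add_dotProduct, smul_dotProduct, dotProduct_smul, smul_eq_mul]
  ring

/-- For a symmetric positive definite `A`, if `xstar` minimizes
`x ↦ ⟨x, m⟩ + ½‖x − x'‖²_A` over the convex set `X` and `ystar` minimizes
`x ↦ ⟨x, v⟩ + ½‖x − x'‖²_A` over `X`, then
`0 ≤ ⟨xstar − ystar, v − m⟩ ≤ 2 (v − m)ᵀ A⁻¹ (v − m)`. -/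
theorem inner_diff_argmin_nonneg_le {d : ℕ}
    (A : Matrix (Fin d) (Fin d) ℝ) (hA : A.PosDef)
    (X : Set (EuclideanSpace ℝ (Fin d))) (hX : Convex ℝ X)
    (m v x' : EuclideanSpace ℝ (Fin d))
    (xstar ystar : EuclideanSpace ℝ (Fin d))
    (hxmem : xstar ∈ X) (hymem : ystar ∈ X)
    (hxmin : ∀ x ∈ X,
      ⟪xstar, m⟫ + (1 / 2) * ((xstar - x') ⬝ᵥ A.mulVec (xstar - x'))
        ≤ ⟪x, m⟫ + (1 / 2) * ((x - x') ⬝ᵥ A.mulVec (x - x')))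
    (hymin : ∀ x ∈ X,
      ⟪ystar, v⟫ + (1 / 2) * ((ystar - x') ⬝ᵥ A.mulVec (ystar - x'))
        ≤ ⟪x, v⟫ + (1 / 2) * ((x - x') ⬝ᵥ A.mulVec (x - x'))) :
    0 ≤ ⟪xstar - ystar, v - m⟫ ∧
      ⟪xstar - ystar, v - m⟫ ≤ 2 * ((v - m) ⬝ᵥ A⁻¹.mulVec (v - m)) := by
  have hmid : (1 / 2 : ℝ) • xstar + (1 / 2 : ℝ) • ystar ∈ X :=
    hX hxmem hymem (by norm_num) (by norm_num) (by norm_num)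
  have hx := hxmin _ hmid
  have hy := hymin _ hmid
  have hsub : ((1 / 2 : ℝ) • xstar + (1 / 2 : ℝ) • ystar).ofLp - x'.ofLp
      = (1 / 2 : ℝ) • (xstar.ofLp - x'.ofLp) + (1 / 2 : ℝ) • (ystar.ofLp - x'.ofLp) := by
    ext i
    simp
    ring
  have hdiff : xstar.ofLp - x'.ofLp - (ystar.ofLp - x'.ofLp) = xstar.ofLp - ystar.ofLp := by
    abel
  simp only [WithLp.ofLp_sub] at hx hy ⊢
  rw [hsub, dotProduct_mulVec_midpoint, hdiff] at hx hy
  simp only [inner_add_left, real_inner_smul_left] at hx hy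
  have hpos := hA.posSemidef.dotProduct_mulVec_nonneg (xstar.ofLp - ystar.ofLp)
  rw [star_trivial] at hpos
  have hyoung :=
    hA.dotProduct_le_quarter_add_inv (xstar.ofLp - ystar.ofLp) (v.ofLp - m.ofLp)
  have hinner : ⟪xstar - ystar, v - m⟫
      = (xstar.ofLp - ystar.ofLp) ⬝ᵥ (v.ofLp - m.ofLp) := by
    rw [EuclideanSpace.inner_eq_star_dotProduct, star_trivial, dotProduct_comm]
    rfl
  have hexpand : ⟪xstar - ystar, v - m⟫
      = ⟪xstar, v⟫ - ⟪ystar, v⟫ - (⟪xstar, m⟫ - ⟪ystar, m⟫) := by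
    rw [inner_sub_right, inner_sub_left, inner_sub_left]
  rw [← hinner] at hyoung
  constructor <;> linarith
end

section
/- Let M be a d×d real symmetric positive semidefinite matrix of rank r. Then det(I + M) ≤ (1 + trace M)^r. -/
open Matrix

/-- The determinant of `1 + A` is the product of `1 + λ` over the eigenvalues `λ` of `A`. -/
theorem Matrix.IsHermitian.det_one_add_eq_prod_eigenvalues {n : Type*} [Fintype n]
    [DecidableEq n] {A : Matrix n n ℝ} (hA : A.IsHermitian) :
    (1 + A).det = ∏ i, (1 + hA.eigenvalues i) := by
  have h : (scalar n (-1 : ℝ) - A).det = ∏ i, (-1 - hA.eigenvalues i) := by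
    rw [← eval_charpoly, hA.charpoly_eq, Polynomial.eval_prod]
    simp
  have hneg : 1 + A = -(scalar n (-1 : ℝ) - A) := by
    rw [map_neg, map_one]
    abel
  rw [hneg, det_neg, h, ← Finset.card_univ, ← Finset.prod_const, ← Finset.prod_mul_distrib]
  exact Finset.prod_congr rfl fun i _ => by ring

/-- For a symmetric positive semidefinite matrix `M` of rank `r`,
`det(I + M) ≤ (1 + trace M)^r`. -/
theorem det_one_add_le_one_add_trace_pow_rank {d : ℕ}
    (M : Matrix (Fin d) (Fin d) ℝ) (hM : M.PosSemidef) :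
    (1 + M).det ≤ (1 + M.trace) ^ M.rank := by
  have hle (i : Fin d) : hM.1.eigenvalues i ≤ M.trace := by
    have htrace : M.trace = ∑ j, hM.1.eigenvalues j := hM.1.trace_eq_sum_eigenvalues
    rw [htrace]
    exact Finset.single_le_sum (fun j _ => hM.eigenvalues_nonneg j) (Finset.mem_univ i)
  rw [hM.1.det_one_add_eq_prod_eigenvalues, hM.1.rank_eq_card_non_zero_eigs,
    Fintype.card_subtype, ← Finset.prod_const, Finset.prod_filter]
  refine Finset.prod_le_prod (fun i _ => by linarith [hM.eigenvalues_nonneg i]) fun i _ => ?_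
  split_ifs with hi
  · linarith [hle i]
  · rw [not_not.mp hi, add_zero]
end
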